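/- If f : X^n → ℝ is sample-monotone, then for any neighboring datasets x, x' ∈ X^n and any t in the image of f, the reflective inverse sensitivities satisfy |Ψ_f(x;t) − Ψ_f(x';t)| ≤ 1. -/

import Mathlib

open scoped Classical

/-- Hamming distance between two datasets in `X^n`. -/
noncomputable def hdist {n : ℕ} {X : Type*} (x x' : Fin n → X) : ℕ :=
  (Finset.univ.filter fun i => x i ≠ x' i).card

/-- The inverse sensitivity `len_f(x;t)`, valued in `ℕ ∪ {∞}` with `inf ∅ = ∞`. -/
noncomputable def invSens {n : ℕ} {X : Type*} (f : (Fin n → X) → ℝ)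
    (x : Fin n → X) (t : ℝ) : ℕ∞ :=
  sInf ((fun x' : Fin n → X => (hdist x x' : ℕ∞)) '' {x' | f x' = t})

/-- `f` is sample-monotone if for every `x` and `s, t` with `f x ≤ s ≤ t` or
`t ≤ s ≤ f x`, we have `len_f(x;s) ≤ len_f(x;t)`. -/
def SampleMonotone {n : ℕ} {X : Type*} (f : (Fin n → X) → ℝ) : Prop :=
  ∀ (x : Fin n → X) (s t : ℝ), ((f x ≤ s ∧ s ≤ t) ∨ (t ≤ s ∧ s ≤ f x)) →
    invSens f x s ≤ invSens f x t

/-- The reflective inverse sensitivity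
`Ψ_f(x;t) = sgn(t − f(x)) · (len_f(x;t) − 1/2)`, where `sgn 0 = 0`. -/
noncomputable def reflSens {n : ℕ} {X : Type*} (f : (Fin n → X) → ℝ)
    (x : Fin n → X) (t : ℝ) : ℝ :=
  Real.sign (t - f x) * (((invSens f x t).toNat : ℝ) - 1 / 2)

theorem hdist_eq_hammingDist {n : ℕ} {X : Type*} (x y : Fin n → X) :
    hdist x y = hammingDist x y := rfl

theorem hdist_comm {n : ℕ} {X : Type*} (x y : Fin n → X) : hdist x y = hdist y x := by
  simp only [hdist_eq_hammingDist, hammingDist_comm]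

theorem hdist_triangle {n : ℕ} {X : Type*} (x y z : Fin n → X) :
    hdist x z ≤ hdist x y + hdist y z := by
  simpa only [hdist_eq_hammingDist] using hammingDist_triangle x y z

theorem invSens_le_hdist {n : ℕ} {X : Type*} (f : (Fin n → X) → ℝ) (x y : Fin n → X) :
    invSens f x (f y) ≤ hdist x y :=
  sInf_le ⟨y, rfl, rfl⟩

theorem exists_invSens_eq_hdist {n : ℕ} {X : Type*} (f : (Fin n → X) → ℝ) (x : Fin n → X)
    {t : ℝ} (ht : t ∈ Set.range f) : ∃ y, f y = t ∧ invSens f x t = hdist x y := by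
  obtain ⟨z, hz⟩ := ht
  have hne : ((fun y : Fin n → X => (hdist x y : ℕ∞)) '' {y | f y = t}).Nonempty :=
    ⟨_, z, hz, rfl⟩
  obtain ⟨y, hy, h⟩ := csInf_mem hne
  exact ⟨y, hy, h.symm⟩

/-- The inverse sensitivity at an attained value is `1`-Lipschitz in the dataset. -/
theorem toNat_invSens_le_add {n : ℕ} {X : Type*} (f : (Fin n → X) → ℝ) (x y : Fin n → X)
    {t : ℝ} (ht : t ∈ Set.range f) :
    (invSens f x t).toNat ≤ hdist x y + (invSens f y t).toNat := by
  obtain ⟨z, rfl, hz⟩ := exists_invSens_eq_hdist f y ht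
  rw [hz, ENat.toNat_natCast]
  exact (ENat.toNat_le_of_le_natCast (invSens_le_hdist f x z)).trans (hdist_triangle x y z)

theorem SampleMonotone.toNat_invSens_le_hdist {n : ℕ} {X : Type*} {f : (Fin n → X) → ℝ}
    (hf : SampleMonotone f) (x y : Fin n → X) {t : ℝ}
    (h : (f x ≤ t ∧ t ≤ f y) ∨ (f y ≤ t ∧ t ≤ f x)) :
    (invSens f x t).toNat ≤ hdist x y :=
  ENat.toNat_le_of_le_natCast ((hf x t (f y) h).trans (invSens_le_hdist f x y))

/-- If `f` is sample-monotone then for neighboring datasets and `t` in the image of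
`f`, `|Ψ_f(x;t) − Ψ_f(x';t)| ≤ 1`. -/
theorem stmt2 {n : ℕ} {X : Type*} (f : (Fin n → X) → ℝ) (hf : SampleMonotone f)
    (x x' : Fin n → X) (hnb : hdist x x' ≤ 1) (t : ℝ) (ht : t ∈ Set.range f) :
    |reflSens f x t - reflSens f x' t| ≤ 1 := by
  have h₁ : ((invSens f x t).toNat : ℝ) ≤ 1 + (invSens f x' t).toNat := by
    have := toNat_invSens_le_add f x x' ht
    exact_mod_cast this.trans (by gcongr)
  have h₂ : ((invSens f x' t).toNat : ℝ) ≤ 1 + (invSens f x t).toNat := by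
    have := toNat_invSens_le_add f x' x ht
    rw [hdist_comm] at this
    exact_mod_cast this.trans (by gcongr)
  have h₃ : (f x ≤ t ∧ t ≤ f x') ∨ (f x' ≤ t ∧ t ≤ f x) →
      ((invSens f x t).toNat : ℝ) ≤ 1 ∧ ((invSens f x' t).toNat : ℝ) ≤ 1 := fun h => by
    have h₄ := (hf.toNat_invSens_le_hdist x x' h).trans hnb
    have h₅ := (hf.toNat_invSens_le_hdist x' x h.symm).trans (hdist_comm x' x ▸ hnb)
    exact ⟨mod_cast h₄, mod_cast h₅⟩
  have h₆ : (0 : ℝ) ≤ (invSens f x t).toNat := Nat.cast_nonneg _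
  have h₇ : (0 : ℝ) ≤ (invSens f x' t).toNat := Nat.cast_nonneg _
  unfold reflSens
  rw [abs_le]
  rcases lt_trichotomy (t - f x) 0 with hx | hx | hx <;>
    rcases lt_trichotomy (t - f x') 0 with hx' | hx' | hx' <;>
    simp only [Real.sign_of_neg, Real.sign_of_pos, Real.sign_zero, hx, hx'] <;>
    first
    | constructor <;> linarith
    | obtain ⟨h₄, h₅⟩ := h₃ (by grind)
      constructor <;> linarith
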